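/- Let M be an L-structure, A ⊆ M, and suppose M is strongly homogeneous over A. Let p, q, r be complete types over A, let C be a correspondence over A between p(M) and q(M), and let C' be a correspondence over A between q(M) and r(M). Define the composition C'∘C = {(a,c) : there exists b with (a,b) ∈ C and (b,c) ∈ C'}. If p(M) and r(M) are commensurable over A, then C and C' are uniform, C'∘C is nonempty with all fibres and cofibres finite, there are positive integers k and ℓ with |(C'∘C)_a| = k for all a ∈ p(M) and |(C'∘C)^c| = ℓ for all c ∈ r(M), and k/ℓ = m_C · m_{C'}. -/

import Mathlib

open FirstOrder Set

namespace Unimod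

universe u v w

variable (L : FirstOrder.Language.{u, v}) {M : Type w} [L.Structure M]

/-- Two tuples (indexed by `α`) satisfy the same `L`-formulas with parameters from `A`,
i.e. they have the same complete type over `A`. -/
def SameType (A : Set M) {α : Type*} (a b : α → M) : Prop :=
  ∀ φ : L.Formula (↥A ⊕ α),
    φ.Realize (Sum.elim (fun x => (x : M)) a) ↔ φ.Realize (Sum.elim (fun x => (x : M)) b)

/-- The set of realizations of the complete type of the tuple `a` over `A`. -/
def typeSet (A : Set M) {α : Type*} (a : α → M) : Set (α → M) :=
  {b | SameType L A a b}

/-- A set is type-definable over `A` if it is an intersection of a family of `A`-definable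
sets. -/
def TypeDefinable (A : Set M) {α : Type*} (s : Set (α → M)) : Prop :=
  ∃ S : Set (Set (α → M)), (∀ t ∈ S, A.Definable L t) ∧ s = ⋂₀ S

/-- View a set of pairs of tuples as a set of `Fin n ⊕ Fin m`-indexed tuples. -/
def pairSet {M : Type w} {n m : ℕ} (C : Set ((Fin n → M) × (Fin m → M))) :
    Set ((Fin n ⊕ Fin m) → M) :=
  {v | (v ∘ Sum.inl, v ∘ Sum.inr) ∈ C}

/-- A correspondence over `A` between `X ⊆ M^n` and `Y ⊆ M^m`: a nonempty subset of `X × Y`,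
type-definable over `A`, all of whose fibres and cofibres are finite. -/
structure IsCorrespondence (A : Set M) {n m : ℕ} (X : Set (Fin n → M)) (Y : Set (Fin m → M))
    (C : Set ((Fin n → M) × (Fin m → M))) : Prop where
  nonempty : C.Nonempty
  subset : C ⊆ X ×ˢ Y
  typeDefinable : TypeDefinable L A (pairSet C)
  finite_fibers : ∀ x ∈ X, {y | (x, y) ∈ C}.Finite
  finite_cofibers : ∀ y ∈ Y, {x | (x, y) ∈ C}.Finite

/-- A uniform correspondence over `A` with constant fibre size `k` and cofibre size `ℓ`. -/
structure IsUniformCorrespondence (A : Set M) {n m : ℕ} (X : Set (Fin n → M))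
    (Y : Set (Fin m → M)) (C : Set ((Fin n → M) × (Fin m → M))) (k ℓ : ℕ)
    extends IsCorrespondence L A X Y C : Prop where
  k_pos : 0 < k
  l_pos : 0 < ℓ
  fiber_card : ∀ x ∈ X, {y | (x, y) ∈ C}.ncard = k
  cofiber_card : ∀ y ∈ Y, {x | (x, y) ∈ C}.ncard = ℓ

/-- A type-definable set `X` is measurable over `A` if every uniform correspondence over `A`
between `X` and itself is balanced. -/
def MeasurableOver (A : Set M) {n : ℕ} (X : Set (Fin n → M)) : Prop :=
  ∀ (C : Set ((Fin n → M) × (Fin n → M))) (k ℓ : ℕ),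
    IsUniformCorrespondence L A X X C k ℓ → k = ℓ

/-- `X` and `Y` are commensurable over `A`, with common ratio `r`. -/
def CommensurableOverWithRatio (A : Set M) {n m : ℕ} (X : Set (Fin n → M))
    (Y : Set (Fin m → M)) (r : ℚ) : Prop :=
  (∃ C k ℓ, IsUniformCorrespondence L A X Y C k ℓ) ∧
    ∀ C k ℓ, IsUniformCorrespondence L A X Y C k ℓ → (k : ℚ) / (ℓ : ℚ) = r

/-- `X` and `Y` are commensurable over `A`: there is a uniform correspondence over `A` between
them, and all such have the same ratio. -/
def CommensurableOver (A : Set M) {n m : ℕ} (X : Set (Fin n → M)) (Y : Set (Fin m → M)) : Prop :=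
  ∃ r : ℚ, CommensurableOverWithRatio L A X Y r

/-- `M` is strongly homogeneous over `A`: any two tuples with the same type over `A` are
conjugate by an automorphism of `M` fixing `A` pointwise. -/
def StronglyHomogeneousOver (A : Set M) : Prop :=
  ∀ (n : ℕ) (a b : Fin n → M), SameType L A a b →
    ∃ σ : M ≃[L] M, (∀ x ∈ A, σ x = x) ∧ ∀ i, σ (a i) = b i

/-- `M` is unimodular (with respect to the cardinal bound `κ` on parameter sets):
whenever `a ≡_A b` are interalgebraic over `A`, then `m(a/A ∪ b) = m(b/A ∪ a)`. -/
def Unimodular (κ : Cardinal.{w}) : Prop :=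
  ∀ A : Set M, Cardinal.mk A < κ → ∀ (n : ℕ) (a b : Fin n → M),
    SameType L A a b →
    (typeSet L (A ∪ Set.range b) a).Finite →
    (typeSet L (A ∪ Set.range a) b).Finite →
    (typeSet L (A ∪ Set.range b) a).ncard = (typeSet L (A ∪ Set.range a) b).ncard

/-- `M` is `κ`-saturated: every finitely satisfiable set of formulas in finitely many free
variables with parameters from a set of size `< κ` is realized in `M`. -/
def Saturated (κ : Cardinal.{w}) : Prop :=
  ∀ A : Set M, Cardinal.mk A < κ →
    ∀ (n : ℕ) (T : Set (L.Formula (↥A ⊕ Fin n))),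
      (∀ T₀ : Finset (L.Formula (↥A ⊕ Fin n)), ↑T₀ ⊆ T →
        ∃ v : Fin n → M, ∀ φ ∈ T₀, φ.Realize (Sum.elim (fun x => (x : M)) v)) →
      ∃ v : Fin n → M, ∀ φ ∈ T, φ.Realize (Sum.elim (fun x => (x : M)) v)

/-- A function `f : X → Y` is relatively definable over `A` if its graph is the intersection
of an `A`-definable set with `X × Y`. -/
def RelativelyDefinableFn (A : Set M) {n m : ℕ} (X : Set (Fin n → M)) (Y : Set (Fin m → M))
    (f : (Fin n → M) → (Fin m → M)) : Prop :=
  ∃ D : Set ((Fin n ⊕ Fin m) → M), A.Definable L D ∧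
    ∀ x ∈ X, ∀ y ∈ Y, (Sum.elim x y ∈ D ↔ f x = y)

/-- The `≡_A`-class of the pair `c`. -/
def pairClass (A : Set M) {n m : ℕ} (c : (Fin n → M) × (Fin m → M)) :
    Set ((Fin n → M) × (Fin m → M)) :=
  {p | SameType L A (Sum.elim c.1 c.2) (Sum.elim p.1 p.2)}

/-- A complete correspondence over `A`: a correspondence which is a single `≡_A`-class. -/
def IsCompleteCorrespondence (A : Set M) {n m : ℕ} (X : Set (Fin n → M)) (Y : Set (Fin m → M))
    (C : Set ((Fin n → M) × (Fin m → M))) : Prop :=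
  IsCorrespondence L A X Y C ∧ ∃ c ∈ C, C = pairClass L A c


section Automorphisms

variable {L} {A : Set M}

lemma SameType.refl {α : Type*} (x : α → M) : SameType L A x x := fun _ => Iff.rfl

lemma SameType.symm {α : Type*} {x y : α → M} (h : SameType L A x y) : SameType L A y x :=
  fun φ => (h φ).symm

lemma SameType.trans {α : Type*} {x y z : α → M} (h : SameType L A x y) (h' : SameType L A y z) :
    SameType L A x z :=
  fun φ => (h φ).trans (h' φ)

lemma SameType.relabel {α β : Type*} {x y : α → M} (h : SameType L A x y) (f : β → α) :
    SameType L A (x ∘ f) (y ∘ f) := by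
  intro φ
  have := h (φ.relabel (Sum.map id f))
  simpa only [Language.Formula.realize_relabel, Sum.elim_comp_map, Function.comp_id] using this

lemma SameType.comp_equiv {α : Type*} (σ : M ≃[L] M) (hσ : ∀ x ∈ A, σ x = x) (x : α → M) :
    SameType L A x (σ ∘ x) := by
  intro φ
  have h : Sum.elim (fun a : A => (a : M)) (σ ∘ x) = σ ∘ Sum.elim (fun a : A => (a : M)) x := by
    ext (i | i)
    · exact (hσ _ i.2).symm
    · rfl
  rw [h, Language.StrongHomClass.realize_formula]

lemma fixes_symm {σ : M ≃[L] M} (hσ : ∀ x ∈ A, σ x = x) : ∀ x ∈ A, σ.symm x = x := by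
  intro x hx
  conv_lhs => rw [← hσ x hx]
  exact σ.symm_apply_apply x

lemma symm_comp_comp {α : Type*} (σ : M ≃[L] M) (x : α → M) : σ.symm ∘ (σ ∘ x) = x := by
  ext i
  exact σ.symm_apply_apply (x i)

lemma comp_symm_comp {α : Type*} (σ : M ≃[L] M) (x : α → M) : σ ∘ (σ.symm ∘ x) = x := by
  ext i
  exact σ.apply_symm_apply (x i)

lemma comp_injective {α : Type*} (σ : M ≃[L] M) :
    Function.Injective (fun x : α → M => σ ∘ x) :=
  Function.LeftInverse.injective (g := fun x : α → M => σ.symm ∘ x) (symm_comp_comp σ)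

lemma TypeDefinable.mem_of_sameType {α : Type*} {s : Set (α → M)} (hs : TypeDefinable L A s)
    {x y : α → M} (h : SameType L A x y) (hx : x ∈ s) : y ∈ s := by
  obtain ⟨S, hS, rfl⟩ := hs
  intro t ht
  obtain ⟨φ, rfl⟩ := definable_iff_exists_formula_sum.1 (hS t ht)
  exact (h φ).1 (hx _ ht)

lemma typeDefinable_typeSet {α : Type*} (x : α → M) : TypeDefinable L A (typeSet L A x) := by
  refine ⟨{t | A.Definable L t ∧ x ∈ t}, fun t ht => ht.1, ?_⟩
  ext y
  constructor
  · rintro h t ⟨ht, hx⟩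
    obtain ⟨φ, rfl⟩ := definable_iff_exists_formula_sum.1 ht
    exact (h φ).1 hx
  · intro h φ
    constructor
    · intro hx
      exact h {v | φ.Realize (Sum.elim (fun a : A => (a : M)) v)}
        ⟨definable_iff_exists_formula_sum.2 ⟨φ, rfl⟩, hx⟩
    · intro hy
      by_contra hx
      exact h {v | φ.Realize (Sum.elim (fun a : A => (a : M)) v)}ᶜ
        ⟨(definable_iff_exists_formula_sum.2 ⟨φ, rfl⟩).compl, hx⟩ hy

lemma StronglyHomogeneousOver.exists_equiv (hhom : StronglyHomogeneousOver L A) {α : Type*}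
    [Finite α] {x y : α → M} (h : SameType L A x y) :
    ∃ σ : M ≃[L] M, (∀ x ∈ A, σ x = x) ∧ σ ∘ x = y := by
  obtain ⟨n, ⟨e⟩⟩ := Finite.exists_equiv_fin α
  obtain ⟨σ, hσ, hxy⟩ := hhom n (x ∘ e.symm) (y ∘ e.symm) (h.relabel e.symm)
  refine ⟨σ, hσ, funext fun i => ?_⟩
  simpa using hxy (e i)

end Automorphisms

section InvariantRelations

variable {L} {A : Set M} {n m : ℕ}

variable (L A) in
/-- A set of pairs of tuples is invariant if it is preserved by the automorphisms fixing `A`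
pointwise. -/
def IsInvariant (R : Set ((Fin n → M) × (Fin m → M))) : Prop :=
  ∀ σ : M ≃[L] M, (∀ x ∈ A, σ x = x) → ∀ x y, (x, y) ∈ R → (σ ∘ x, σ ∘ y) ∈ R

variable {R : Set ((Fin n → M) × (Fin m → M))}

lemma IsInvariant.mem_iff (hR : IsInvariant L A R) {σ : M ≃[L] M} (hσ : ∀ x ∈ A, σ x = x)
    {x : Fin n → M} {y : Fin m → M} : (σ ∘ x, σ ∘ y) ∈ R ↔ (x, y) ∈ R := by
  refine ⟨fun h => ?_, hR σ hσ x y⟩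
  simpa only [symm_comp_comp] using hR σ.symm (fixes_symm hσ) _ _ h

lemma IsInvariant.preimage_swap (hR : IsInvariant L A R) :
    IsInvariant L A (Prod.swap ⁻¹' R) :=
  fun σ hσ x y h => hR σ hσ y x h

lemma IsInvariant.fiber_comp (hR : IsInvariant L A R) {σ : M ≃[L] M} (hσ : ∀ x ∈ A, σ x = x)
    (x : Fin n → M) : {y | (σ ∘ x, y) ∈ R} = (fun y => σ ∘ y) '' {y | (x, y) ∈ R} := by
  ext y
  constructor
  · intro h
    refine ⟨σ.symm ∘ y, ?_, comp_symm_comp σ y⟩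
    rw [mem_ofPred_eq, ← hR.mem_iff hσ, comp_symm_comp]
    exact h
  · rintro ⟨y, h, rfl⟩
    exact hR σ hσ x y h

lemma IsInvariant.ncard_fiber_eq (hhom : StronglyHomogeneousOver L A) (hR : IsInvariant L A R)
    {x x' : Fin n → M} (h : SameType L A x x') :
    {y | (x', y) ∈ R}.ncard = {y | (x, y) ∈ R}.ncard := by
  obtain ⟨σ, hσ, rfl⟩ := hhom.exists_equiv h
  rw [hR.fiber_comp hσ, ncard_image_of_injective _ (comp_injective σ)]

lemma IsInvariant.ncard_cofiber_eq (hhom : StronglyHomogeneousOver L A) (hR : IsInvariant L A R)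
    {y y' : Fin m → M} (h : SameType L A y y') :
    {x | (x, y') ∈ R}.ncard = {x | (x, y) ∈ R}.ncard :=
  hR.preimage_swap.ncard_fiber_eq hhom h

lemma IsCorrespondence.isInvariant {X : Set (Fin n → M)} {Y : Set (Fin m → M)}
    (hR : IsCorrespondence L A X Y R) : IsInvariant L A R := by
  intro σ hσ x y h
  exact hR.typeDefinable.mem_of_sameType (SameType.comp_equiv σ hσ (Sum.elim x y)) h

/-- Between complete types, correspondences are automatically uniform. -/
lemma IsCorrespondence.exists_isUniformCorrespondence (hhom : StronglyHomogeneousOver L A)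
    {a : Fin n → M} {b : Fin m → M}
    (hR : IsCorrespondence L A (typeSet L A a) (typeSet L A b) R) :
    ∃ k l, IsUniformCorrespondence L A (typeSet L A a) (typeSet L A b) R k l := by
  obtain ⟨⟨x, y⟩, hxy⟩ := hR.nonempty
  obtain ⟨hx, hy⟩ := hR.subset hxy
  refine ⟨{y | (x, y) ∈ R}.ncard, {x | (x, y) ∈ R}.ncard, hR, ?_, ?_, ?_, ?_⟩
  · exact (ncard_pos (hR.finite_fibers x hx)).2 ⟨y, hxy⟩
  · exact (ncard_pos (hR.finite_cofibers y hy)).2 ⟨x, hxy⟩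
  · exact fun x' hx' => hR.isInvariant.ncard_fiber_eq hhom (hx.symm.trans hx')
  · exact fun y' hy' => hR.isInvariant.ncard_cofiber_eq hhom (hy.symm.trans hy')

lemma pairClass_eq_iff {p q : (Fin n → M) × (Fin m → M)} :
    pairClass L A q = pairClass L A p ↔ q ∈ pairClass L A p := by
  refine ⟨fun h => h ▸ SameType.refl _, fun h => ?_⟩
  ext s
  exact ⟨fun hs => SameType.trans h hs, fun hs => (SameType.symm h).trans hs⟩

lemma exists_equiv_of_mem_pairClass (hhom : StronglyHomogeneousOver L A)
    {p q : (Fin n → M) × (Fin m → M)} (h : q ∈ pairClass L A p) :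
    ∃ σ : M ≃[L] M, (∀ x ∈ A, σ x = x) ∧ σ ∘ p.1 = q.1 ∧ σ ∘ p.2 = q.2 := by
  obtain ⟨σ, hσ, he⟩ := hhom.exists_equiv h
  exact ⟨σ, hσ, funext fun i => congrFun he (Sum.inl i), funext fun i => congrFun he (Sum.inr i)⟩

lemma pairClass_subset (hhom : StronglyHomogeneousOver L A) (hR : IsInvariant L A R)
    {p : (Fin n → M) × (Fin m → M)} (hp : p ∈ R) : pairClass L A p ⊆ R := by
  rintro ⟨x, y⟩ h
  obtain ⟨σ, hσ, rfl, rfl⟩ := exists_equiv_of_mem_pairClass hhom h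
  exact hR σ hσ _ _ hp

lemma isCorrespondence_pairClass (hhom : StronglyHomogeneousOver L A) (hR : IsInvariant L A R)
    {X : Set (Fin n → M)} {Y : Set (Fin m → M)} (hsub : R ⊆ X ×ˢ Y)
    (hfib : ∀ x ∈ X, {y | (x, y) ∈ R}.Finite) (hcofib : ∀ y ∈ Y, {x | (x, y) ∈ R}.Finite)
    {p : (Fin n → M) × (Fin m → M)} (hp : p ∈ R) :
    IsCorrespondence L A X Y (pairClass L A p) := by
  have hpR := pairClass_subset hhom hR hp
  refine ⟨⟨p, SameType.refl _⟩, hpR.trans hsub, ?_,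
    fun x hx => (hfib x hx).subset fun _ h => hpR h,
    fun y hy => (hcofib y hy).subset fun _ h => hpR h⟩
  convert typeDefinable_typeSet (L := L) (A := A) (Sum.elim p.1 p.2) using 1
  ext v
  simp [pairSet, pairClass, typeSet]

/-- For an invariant weight on a fibrewise finite invariant relation between commensurable complete
types, the total weights of a fibre and of a cofibre are in the ratio of the two types. -/
lemma sum_fiber_eq_ratio_mul_sum_cofiber (hhom : StronglyHomogeneousOver L A)
    (hR : IsInvariant L A R) {a : Fin n → M} {c : Fin m → M}
    (hsub : R ⊆ typeSet L A a ×ˢ typeSet L A c)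
    (hfib : ∀ x ∈ typeSet L A a, {y | (x, y) ∈ R}.Finite)
    (hcofib : ∀ y ∈ typeSet L A c, {x | (x, y) ∈ R}.Finite) {r : ℚ}
    (hr : CommensurableOverWithRatio L A (typeSet L A a) (typeSet L A c) r)
    (w : (Fin n → M) × (Fin m → M) → ℕ)
    (hw : ∀ p q, q ∈ pairClass L A p → w q = w p)
    {x : Fin n → M} (hx : x ∈ typeSet L A a) {z : Fin m → M} (hz : z ∈ typeSet L A c) :
    ((∑ y ∈ (hfib x hx).toFinset, w (x, y) : ℕ) : ℚ) =
      r * ((∑ y ∈ (hcofib z hz).toFinset, w (y, z) : ℕ) : ℚ) := by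
  classical
  have class_uniform {p : (Fin n → M) × (Fin m → M)} (hp : p ∈ R) :=
    (isCorrespondence_pairClass hhom hR hsub hfib hcofib hp).exists_isUniformCorrespondence hhom
  set S := (hfib x hx).toFinset with hS
  set T := (hcofib z hz).toFinset with hT
  have hmaps : ∀ y ∈ T, pairClass L A (y, z) ∈ S.image fun y => pairClass L A (x, y) := by
    intro y hy
    have hyR : (y, z) ∈ R := by simpa [hT] using hy
    obtain ⟨k, l, hu⟩ := class_uniform hyR
    obtain ⟨y', hy'⟩ := nonempty_of_ncard_ne_zero
      (by rw [hu.fiber_card x hx]; exact hu.k_pos.ne')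
    refine Finset.mem_image.2 ⟨y', ?_, pairClass_eq_iff.2 hy'⟩
    simpa [hS] using pairClass_subset hhom hR hyR hy'
  rw [← Finset.sum_fiberwise_of_maps_to (g := fun y => pairClass L A (x, y))
      (fun y hy => Finset.mem_image_of_mem (fun y => pairClass L A (x, y)) hy) (fun y => w (x, y)),
    ← Finset.sum_fiberwise_of_maps_to hmaps (fun y => w (y, z))]
  push_cast
  rw [Finset.mul_sum]
  refine Finset.sum_congr rfl fun t ht => ?_
  obtain ⟨y, hy, rfl⟩ := Finset.mem_image.1 ht
  have hyR : (x, y) ∈ R := by simpa [hS] using hy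
  have hpR := pairClass_subset hhom hR hyR
  obtain ⟨k, l, hu⟩ := class_uniform hyR
  have hk : (S.filter fun y' => pairClass L A (x, y') = pairClass L A (x, y)).card = k := by
    rw [← hu.fiber_card x hx, ← ncard_coe_finset]
    congr 1
    ext y'
    simpa [hS, pairClass_eq_iff] using fun h => hpR h
  have hl : (T.filter fun y' => pairClass L A (y', z) = pairClass L A (x, y)).card = l := by
    rw [← hu.cofiber_card z hz, ← ncard_coe_finset]
    congr 1
    ext y'
    simpa [hT, pairClass_eq_iff] using fun h => hpR h
  rw [Finset.sum_congr rfl (g := fun _ => (w (x, y) : ℚ)), Finset.sum_const, hk,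
    Finset.sum_congr rfl (g := fun _ => (w (x, y) : ℚ)), Finset.sum_const, hl,
    ← hr.2 _ k l hu]
  · have : (l : ℚ) ≠ 0 := by exact_mod_cast hu.l_pos.ne'
    simp only [nsmul_eq_mul]
    field_simp
  · intro y' hy'
    rw [hw _ _ (pairClass_eq_iff.1 (Finset.mem_filter.1 hy').2)]
  · intro y' hy'
    rw [hw _ _ (pairClass_eq_iff.1 (Finset.mem_filter.1 hy').2)]

end InvariantRelations

/-- Counting the pairs `(y, z)` with `y ∈ S` and `T y z` in two ways. -/
lemma sum_ncard_eq_ncard_mul {β γ : Type*} {S : Set β} (hS : S.Finite) (T : β → γ → Prop) {k : ℕ}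
    (hk : ∀ y ∈ S, {z | T y z}.ncard = k) (hD : {z | ∃ y, y ∈ S ∧ T y z}.Finite) :
    ∑ z ∈ hD.toFinset, {y | y ∈ S ∧ T y z}.ncard = S.ncard * k := by
  classical
  have h := Finset.sum_card_bipartiteAbove_eq_sum_card_bipartiteBelow (s := hS.toFinset)
    (t := hD.toFinset) T
  rw [Finset.sum_congr rfl (g := fun _ => k), Finset.sum_const, smul_eq_mul,
    ← ncard_eq_toFinset_card S hS] at h
  · rw [h]
    refine Finset.sum_congr rfl fun z _ => ?_
    rw [← ncard_coe_finset]
    congr 1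
    ext y
    simp [Finset.bipartiteBelow]
  · intro y hy
    have hy : y ∈ S := by simpa using hy
    rw [← hk y hy, ← ncard_coe_finset]
    congr 1
    ext z
    simpa [Finset.bipartiteAbove] using fun h => ⟨y, hy, h⟩

/-- composition of correspondences between complete types. If `p(M)` and `r(M)`
are commensurable over `A`, then `C` and `C'` are uniform, the composition `C' ∘ C` is a
correspondence with constant fibre sizes `k, ℓ`, and `k/ℓ = m_C · m_{C'}`. -/
theorem statement9 (L : FirstOrder.Language.{u, v}) (M : Type w) [L.Structure M]
    (A : Set M) (hhom : StronglyHomogeneousOver L A) (n₁ n₂ n₃ : ℕ)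
    (a : Fin n₁ → M) (b : Fin n₂ → M) (c : Fin n₃ → M)
    (C : Set ((Fin n₁ → M) × (Fin n₂ → M))) (C' : Set ((Fin n₂ → M) × (Fin n₃ → M)))
    (hC : IsCorrespondence L A (typeSet L A a) (typeSet L A b) C)
    (hC' : IsCorrespondence L A (typeSet L A b) (typeSet L A c) C')
    (hcomm : CommensurableOver L A (typeSet L A a) (typeSet L A c)) :
    (∃ k ℓ, IsUniformCorrespondence L A (typeSet L A a) (typeSet L A b) C k ℓ) ∧
    (∃ k ℓ, IsUniformCorrespondence L A (typeSet L A b) (typeSet L A c) C' k ℓ) ∧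
    ({p : (Fin n₁ → M) × (Fin n₃ → M) | ∃ y, (p.1, y) ∈ C ∧ (y, p.2) ∈ C'}.Nonempty) ∧
    (∀ x ∈ typeSet L A a, {z | ∃ y, (x, y) ∈ C ∧ (y, z) ∈ C'}.Finite) ∧
    (∀ z ∈ typeSet L A c, {x | ∃ y, (x, y) ∈ C ∧ (y, z) ∈ C'}.Finite) ∧
    ∃ k ℓ : ℕ, 0 < k ∧ 0 < ℓ ∧
      (∀ x ∈ typeSet L A a, {z | ∃ y, (x, y) ∈ C ∧ (y, z) ∈ C'}.ncard = k) ∧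
      (∀ z ∈ typeSet L A c, {x | ∃ y, (x, y) ∈ C ∧ (y, z) ∈ C'}.ncard = ℓ) ∧
      (∀ k₁ ℓ₁ k₂ ℓ₂ : ℕ,
        IsUniformCorrespondence L A (typeSet L A a) (typeSet L A b) C k₁ ℓ₁ →
        IsUniformCorrespondence L A (typeSet L A b) (typeSet L A c) C' k₂ ℓ₂ →
        (k : ℚ) / (ℓ : ℚ) = ((k₁ : ℚ) / (ℓ₁ : ℚ)) * ((k₂ : ℚ) / (ℓ₂ : ℚ))) := by
  obtain ⟨k₁, l₁, hu⟩ := hC.exists_isUniformCorrespondence hhom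
  obtain ⟨k₂, l₂, hu'⟩ := hC'.exists_isUniformCorrespondence hhom
  obtain ⟨r, hr⟩ := hcomm
  obtain ⟨⟨x₀, y₀⟩, hxy⟩ := hC.nonempty
  obtain ⟨hx₀, hy₀⟩ := hC.subset hxy
  obtain ⟨z₀, hyz⟩ := nonempty_of_ncard_ne_zero
    (by rw [hu'.fiber_card y₀ hy₀]; exact hu'.k_pos.ne')
  have hz₀ := (hC'.subset hyz).2
  set D : Set ((Fin n₁ → M) × (Fin n₃ → M)) := {p | ∃ y, (p.1, y) ∈ C ∧ (y, p.2) ∈ C'} with hD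
  have hDinv : IsInvariant L A D := by
    rintro σ hσ x z ⟨y, h, h'⟩
    exact ⟨σ ∘ y, hC.isInvariant σ hσ _ _ h, hC'.isInvariant σ hσ _ _ h'⟩
  have hDsub : D ⊆ typeSet L A a ×ˢ typeSet L A c := by
    rintro ⟨x, z⟩ ⟨y, h, h'⟩
    exact ⟨(hC.subset h).1, (hC'.subset h').2⟩
  have hfib : ∀ x ∈ typeSet L A a, {z | (x, z) ∈ D}.Finite := by
    intro x hx
    refine ((hC.finite_fibers x hx).biUnion fun y hy =>
      hC'.finite_fibers y (hC.subset hy).2).subset ?_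
    rintro z ⟨y, h, h'⟩
    exact mem_biUnion h h'
  have hcofib : ∀ z ∈ typeSet L A c, {x | (x, z) ∈ D}.Finite := by
    intro z hz
    refine ((hC'.finite_cofibers z hz).biUnion fun y hy =>
      hC.finite_cofibers y (hC'.subset hy).1).subset ?_
    rintro x ⟨y, h, h'⟩
    exact mem_biUnion h' h
  have hcard : (({z | (x₀, z) ∈ D}.ncard : ℕ) : ℚ) = r * ({x | (x, z₀) ∈ D}.ncard : ℕ) := by
    have := sum_fiber_eq_ratio_mul_sum_cofiber hhom hDinv hDsub hfib hcofib hr (fun _ => 1)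
      (fun _ _ _ => rfl) hx₀ hz₀
    simpa only [Finset.sum_const, smul_eq_mul, mul_one, ← ncard_eq_toFinset_card] using this
  have hmul : ((k₁ * k₂ : ℕ) : ℚ) = r * ((l₂ * l₁ : ℕ) : ℚ) := by
    have h := sum_fiber_eq_ratio_mul_sum_cofiber hhom hDinv hDsub hfib hcofib hr
      (fun p => {y | (p.1, y) ∈ C ∧ (y, p.2) ∈ C'}.ncard) ?_ hx₀ hz₀
    · have h₁ := sum_ncard_eq_ncard_mul (hC.finite_fibers x₀ hx₀) (fun y z => (y, z) ∈ C')
        (fun y hy => hu'.fiber_card y (hC.subset hy).2) (hfib x₀ hx₀)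
      have h₂ := sum_ncard_eq_ncard_mul (hC'.finite_cofibers z₀ hz₀) (fun y x => (x, y) ∈ C)
        (fun y hy => hu.cofiber_card y (hC'.subset hy).1)
        ((hcofib z₀ hz₀).subset fun x ⟨y, h, h'⟩ => ⟨y, h', h⟩)
      rw [hu.fiber_card x₀ hx₀] at h₁
      rw [hu'.cofiber_card z₀ hz₀] at h₂
      rw [← h₁, ← h₂]
      simpa only [and_comm, hD, mem_ofPred_eq] using h
    · rintro ⟨x, z⟩ ⟨x', z'⟩ h
      obtain ⟨σ, hσ, rfl, rfl⟩ := exists_equiv_of_mem_pairClass hhom h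
      rw [← ncard_image_of_injective {y | (x, y) ∈ C ∧ (y, z) ∈ C'} (comp_injective σ)]
      congr 1
      ext y
      constructor
      · rintro ⟨h, h'⟩
        refine ⟨σ.symm ∘ y, ⟨?_, ?_⟩, comp_symm_comp σ y⟩
        · rw [← hC.isInvariant.mem_iff hσ, comp_symm_comp]
          exact h
        · rw [← hC'.isInvariant.mem_iff hσ, comp_symm_comp]
          exact h'
      · rintro ⟨y, ⟨h, h'⟩, rfl⟩
        exact ⟨hC.isInvariant σ hσ _ _ h, hC'.isInvariant σ hσ _ _ h'⟩
  have hk := (ncard_pos (hfib x₀ hx₀)).2 ⟨z₀, y₀, hxy, hyz⟩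
  have hl := (ncard_pos (hcofib z₀ hz₀)).2 ⟨x₀, y₀, hxy, hyz⟩
  refine ⟨⟨k₁, l₁, hu⟩, ⟨k₂, l₂, hu'⟩, ⟨(x₀, z₀), y₀, hxy, hyz⟩, hfib, hcofib,
    _, _, hk, hl, fun x hx => hDinv.ncard_fiber_eq hhom (hx₀.symm.trans hx),
    fun z hz => hDinv.ncard_cofiber_eq hhom (hz₀.symm.trans hz), ?_⟩
  intro k₁' l₁' k₂' l₂' hv hv'
  obtain rfl : k₁ = k₁' := (hu.fiber_card x₀ hx₀).symm.trans (hv.fiber_card x₀ hx₀)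
  obtain rfl : l₁ = l₁' := (hu.cofiber_card y₀ hy₀).symm.trans (hv.cofiber_card y₀ hy₀)
  obtain rfl : k₂ = k₂' := (hu'.fiber_card y₀ hy₀).symm.trans (hv'.fiber_card y₀ hy₀)
  obtain rfl : l₂ = l₂' := (hu'.cofiber_card z₀ hz₀).symm.trans (hv'.cofiber_card z₀ hz₀)
  have hl₁ : (l₁ : ℚ) ≠ 0 := by exact_mod_cast hu.l_pos.ne'
  have hl₂ : (l₂ : ℚ) ≠ 0 := by exact_mod_cast hu'.l_pos.ne'
  have hl' : ({x | (x, z₀) ∈ D}.ncard : ℚ) ≠ 0 := by exact_mod_cast hl.ne'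
  push_cast at hmul
  rw [hcard, mul_div_assoc, div_self hl', mul_one, div_mul_div_comm, hmul]
  field_simp

end Unimod
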